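/- Summed gradient bound and vanishing partial gradients for HOQRI. Let X be an N-way tensor, let {U_t}_{t≥0} be HOQRI iterates (with each updated TTMcTC matrix assumed to have full column rank), and let f_sup be the supremum of f over all tuples of factor matrices with orthonormal columns. Then for every T ≥ 0, ∑_{t=0}^{T} ‖ 2 A_t^{(n_t)} − 2 U_t^{(n_t)} M_t^{(n_t)} ‖_F² ≤ 4 f_sup², and consequently ‖ 2 A_t^{(n_t)} − 2 U_t^{(n_t)} M_t^{(n_t)} ‖_F → 0 as t → ∞, where n_t is the block updated at step t, A_t^{(n)} is the mode-n TTMcTC matrix at {U_t}, and M_t^{(n)} is the mode-n Gram matrix of the core tensor at {U_t}. -/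

import Mathlib

open Matrix Finset

noncomputable section

/-- Squared Frobenius norm of a real matrix: `‖M‖_F² = tr(Mᵀ M)`. -/
def frobSq {I K : ℕ} (M : Matrix (Fin I) (Fin K) ℝ) : ℝ := Matrix.trace (Mᵀ * M)

/-- The Tucker core tensor: `G(k) = ∑_i X(i) ∏_n U⁽ⁿ⁾(iₙ, kₙ)`. -/
def core {N : ℕ} {Idim Kdim : Fin N → ℕ} (X : (∀ n, Fin (Idim n)) → ℝ)
    (U : ∀ n, Matrix (Fin (Idim n)) (Fin (Kdim n)) ℝ) :
    (∀ n, Fin (Kdim n)) → ℝ :=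
  fun k => ∑ i : ∀ n, Fin (Idim n), X i * ∏ n, U n (i n) (k n)

/-- The Tucker objective `f({U}) = ∑_k G(k)²`, the squared norm of the core. -/
def obj {N : ℕ} {Idim Kdim : Fin N → ℕ} (X : (∀ n, Fin (Idim n)) → ℝ)
    (U : ∀ n, Matrix (Fin (Idim n)) (Fin (Kdim n)) ℝ) : ℝ :=
  ∑ k : ∀ n, Fin (Kdim n), (core X U k) ^ 2

/-- The mode-`n` TTMcTC matrix `A⁽ⁿ⁾`, with entries
`A⁽ⁿ⁾(a,b) = ∑_{i : iₙ = a} ∑_{k : kₙ = b} X(i) G(k) ∏_{ν ≠ n} U⁽ᵛ⁾(i_ν, k_ν)`. -/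
def ttmctc {N : ℕ} {Idim Kdim : Fin N → ℕ} (X : (∀ n, Fin (Idim n)) → ℝ)
    (n : Fin N) (U : ∀ m, Matrix (Fin (Idim m)) (Fin (Kdim m)) ℝ) :
    Matrix (Fin (Idim n)) (Fin (Kdim n)) ℝ :=
  Matrix.of fun a b =>
    ∑ i : ∀ ν, Fin (Idim ν), ∑ k : ∀ ν, Fin (Kdim ν),
      if i n = a ∧ k n = b then
        X i * core X U k * ∏ ν ∈ Finset.univ.erase n, U ν (i ν) (k ν)
      else 0

/-- The mode-`n` Gram matrix of the core, `M⁽ⁿ⁾ = G₍ₙ₎ G₍ₙ₎ᵀ`, with entries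
`M⁽ⁿ⁾(a,b) = ∑_{k_ν, ν≠n} G(…,a,…) G(…,b,…)`. -/
def gramCore {N : ℕ} {Idim Kdim : Fin N → ℕ} (X : (∀ n, Fin (Idim n)) → ℝ)
    (n : Fin N) (U : ∀ m, Matrix (Fin (Idim m)) (Fin (Kdim m)) ℝ) :
    Matrix (Fin (Kdim n)) (Fin (Kdim n)) ℝ :=
  Matrix.of fun a b =>
    ∑ k : ∀ ν, Fin (Kdim ν),
      if k n = a then core X U k * core X U (Function.update k n b) else 0

/-- The block updated at step `t` of HOQRI: `n_t = (t mod N) + 1` (here 0-indexed as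
`t mod N`). -/
def blockAt {N : ℕ} (hN : 0 < N) (t : ℕ) : Fin N := ⟨t % N, Nat.mod_lt t hN⟩

/-- `U : ℕ → …` is a sequence of HOQRI iterates: the initial factors have orthonormal
columns, and at each step `t` the block `n_t = (t mod N) + 1` is replaced by a matrix
with orthonormal columns whose column space equals the column space of the TTMcTC
matrix `A⁽ⁿᵗ⁾` computed at `{U_t}` (assumed to have full column rank), while all
other blocks are unchanged. -/
def IsHOQRI {N : ℕ} (hN : 0 < N) {Idim Kdim : Fin N → ℕ}
    (X : (∀ n, Fin (Idim n)) → ℝ)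
    (U : ℕ → ∀ n, Matrix (Fin (Idim n)) (Fin (Kdim n)) ℝ) : Prop :=
  (∀ n, (U 0 n)ᵀ * U 0 n = 1) ∧
  ∀ t : ℕ,
    ((U (t + 1) (blockAt hN t))ᵀ * U (t + 1) (blockAt hN t) = 1) ∧
    Function.Injective (ttmctc X (blockAt hN t) (U t)).mulVecLin ∧
    LinearMap.range (U (t + 1) (blockAt hN t)).mulVecLin =
      LinearMap.range (ttmctc X (blockAt hN t) (U t)).mulVecLin ∧
    ∀ m : Fin N, m ≠ blockAt hN t → U (t + 1) m = U t m

/-- The trace form `tr(Mᵀ M)` is the sum of the squared entries. -/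
lemma trace_transpose_mul_self_eq_sum {ι κ : Type*} [Fintype ι] [Fintype κ]
    (M : Matrix ι κ ℝ) : trace (Mᵀ * M) = ∑ j, ∑ i, M i j ^ 2 := by
  simp [trace, mul_apply, sq]

lemma trace_transpose_mul_self_nonneg {ι κ : Type*} [Fintype ι] [Fintype κ]
    (M : Matrix ι κ ℝ) : 0 ≤ trace (Mᵀ * M) := by
  rw [trace_transpose_mul_self_eq_sum]
  positivity

/-- Submultiplicativity of the squared Frobenius norm. -/
lemma trace_transpose_mul_self_mul_le {ι κ μ : Type*} [Fintype ι] [Fintype κ] [Fintype μ]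
    (A : Matrix ι κ ℝ) (B : Matrix κ μ ℝ) :
    trace ((A * B)ᵀ * (A * B)) ≤ trace (Aᵀ * A) * trace (Bᵀ * B) := by
  simp only [trace_transpose_mul_self_eq_sum]
  rw [Finset.mul_sum]
  refine Finset.sum_le_sum fun j _ => ?_
  rw [Finset.sum_comm, Finset.sum_mul]
  refine Finset.sum_le_sum fun i _ => ?_
  simpa only [mul_apply] using
    Finset.sum_mul_sq_le_sq_mul_sq Finset.univ (fun k => A i k) (fun k => B k j)

/-- One step of orthogonal (subspace) iteration for the Gram matrix `Y * Yᵀ` controls the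
projected gradient of `U ↦ tr (Uᵀ * Y * Yᵀ * U)`. -/
lemma projected_gradient_sq_le {ι κ μ : Type*} [Fintype ι] [Fintype κ] [Fintype μ]
    [DecidableEq κ] (Y : Matrix ι μ ℝ) (U V : Matrix ι κ ℝ)
    (hU : Uᵀ * U = 1) (hV : Vᵀ * V = 1)
    (hinj : Function.Injective (Y * (Yᵀ * U)).mulVecLin)
    (hrange : LinearMap.range V.mulVecLin = LinearMap.range (Y * (Yᵀ * U)).mulVecLin) :
    trace ((Y * (Yᵀ * U) - U * ((Yᵀ * U)ᵀ * (Yᵀ * U)))ᵀ *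
        (Y * (Yᵀ * U) - U * ((Yᵀ * U)ᵀ * (Yᵀ * U)))) ≤
      trace ((Yᵀ * U)ᵀ * (Yᵀ * U)) *
        (trace ((Yᵀ * V)ᵀ * (Yᵀ * V)) - trace ((Yᵀ * U)ᵀ * (Yᵀ * U))) := by
  obtain ⟨P, hP⟩ : ∃ P, P = Yᵀ * U := ⟨_, rfl⟩
  obtain ⟨Q, hQ⟩ : ∃ Q, Q = Yᵀ * V := ⟨_, rfl⟩
  obtain ⟨A, hA⟩ : ∃ A, A = Y * P := ⟨_, rfl⟩
  obtain ⟨M, hM⟩ : ∃ M, M = Pᵀ * P := ⟨_, rfl⟩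
  rw [← hP, ← hA] at hinj hrange
  rw [← hP, ← hQ, ← hA, ← hM]
  have hVA : V * (Vᵀ * A) = A := by
    refine ext_of_mulVec_single fun j => ?_
    obtain ⟨y, hy⟩ : A *ᵥ Pi.single j 1 ∈ LinearMap.range V.mulVecLin := by
      rw [hrange]
      exact ⟨_, rfl⟩
    rw [mulVecLin_apply] at hy
    rw [← mulVec_mulVec, ← mulVec_mulVec, ← hy, mulVec_mulVec y Vᵀ V, hV, one_mulVec]
  have hMt : Mᵀ = M := by rw [hM, transpose_mul, transpose_transpose]
  have hUA : Uᵀ * A = M := by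
    rw [hA, hM, ← Matrix.mul_assoc, hP]
    simp only [transpose_mul, transpose_transpose]
  have hAU : Aᵀ * U = M := by
    rw [← hMt, ← hUA, transpose_mul, transpose_transpose]
  have hVQ : Vᵀ * A = Qᵀ * P := by
    rw [hA, ← Matrix.mul_assoc, hQ]
    simp only [transpose_mul, transpose_transpose]
  have hunit : IsUnit M := by
    rw [← mulVec_injective_iff_isUnit]
    refine (injective_iff_map_eq_zero M.mulVecLin).2 fun x hx => ?_
    rw [mulVecLin_apply] at hx
    have hPx : P *ᵥ x = 0 := by
      have h : (P *ᵥ x) ⬝ᵥ (P *ᵥ x) = 0 := by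
        rw [dotProduct_mulVec, ← mulVec_transpose, mulVec_mulVec, ← hM, hx, zero_dotProduct]
      exact dotProduct_self_eq_zero.1 h
    refine hinj ?_
    rw [mulVecLin_apply, map_zero, hA, ← mulVec_mulVec, hPx, mulVec_zero]
  have hdet : IsUnit M.det := (isUnit_iff_isUnit_det M).1 hunit
  have hN1 : M⁻¹ * M = 1 := nonsing_inv_mul M hdet
  have hN2 : M * M⁻¹ = 1 := mul_nonsing_inv M hdet
  have hNt : (M⁻¹)ᵀ = M⁻¹ := by rw [transpose_nonsing_inv, hMt]
  obtain ⟨S, hS⟩ : ∃ S, S = M⁻¹ := ⟨_, rfl⟩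
  rw [← hS] at hN1 hN2 hNt
  obtain ⟨R, hR⟩ : ∃ R, R = Vᵀ * A := ⟨_, rfl⟩
  rw [← hR] at hVA hVQ
  have hAA : Aᵀ * A = Rᵀ * R := by
    rw [← hVA, transpose_mul, Matrix.mul_assoc, ← Matrix.mul_assoc Vᵀ, hV, Matrix.one_mul]
  have hlower : trace (S * (Aᵀ * A)) ≤ trace (Qᵀ * Q) := by
    have h := trace_transpose_mul_self_nonneg (Q - P * (S * Rᵀ))
    have h1 : Qᵀ * (P * (S * Rᵀ)) = R * (S * Rᵀ) := by
      rw [← Matrix.mul_assoc, ← hVQ]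
    have h2 : (P * (S * Rᵀ))ᵀ * Q = R * (S * Rᵀ) := by
      rw [← transpose_transpose ((P * (S * Rᵀ))ᵀ * Q), transpose_mul, transpose_transpose, h1]
      simp only [transpose_mul, transpose_transpose, hNt, Matrix.mul_assoc]
    have h3 : (P * (S * Rᵀ))ᵀ * (P * (S * Rᵀ)) = R * (S * Rᵀ) := by
      have : (P * (S * Rᵀ))ᵀ * (P * (S * Rᵀ)) = R * (S * ((Pᵀ * P) * S) * Rᵀ) := by
        simp only [transpose_mul, transpose_transpose, hNt, Matrix.mul_assoc]
      rw [this, ← hM, hN2, Matrix.mul_one]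
    have h4 : trace (R * (S * Rᵀ)) = trace (S * (Aᵀ * A)) := by
      rw [trace_mul_comm, hAA, Matrix.mul_assoc]
    rw [transpose_sub, Matrix.sub_mul, Matrix.mul_sub, Matrix.mul_sub, h1, h2, h3] at h
    simp only [trace_sub, h4] at h
    linarith
  obtain ⟨E, hE⟩ : ∃ E, E = A - U * M := ⟨_, rfl⟩
  rw [← hE]
  have hEE : Eᵀ * E = Aᵀ * A - M * M := by
    have h : (U * M)ᵀ * (U * M) = M * M := by
      rw [transpose_mul, hMt, Matrix.mul_assoc, ← Matrix.mul_assoc Uᵀ, hU, Matrix.one_mul]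
    have h' : (U * M)ᵀ * A = M * M := by
      rw [transpose_mul, hMt, Matrix.mul_assoc, hUA]
    rw [hE, transpose_sub, Matrix.sub_mul, Matrix.mul_sub, Matrix.mul_sub, h, h',
      ← Matrix.mul_assoc, hAU, sub_self, sub_zero]
  have hgain : trace ((P * (S * Eᵀ))ᵀ * (P * (S * Eᵀ))) = trace (S * (Aᵀ * A)) - trace M := by
    have h : (P * (S * Eᵀ))ᵀ * (P * (S * Eᵀ)) = E * (S * ((Pᵀ * P) * S) * Eᵀ) := by
      simp only [transpose_mul, transpose_transpose, hNt, Matrix.mul_assoc]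
    rw [h, ← hM, hN2, Matrix.mul_one, trace_mul_comm, Matrix.mul_assoc, hEE, Matrix.mul_sub,
      ← Matrix.mul_assoc S M, hN1, Matrix.one_mul, trace_sub]
  have hfac : Pᵀ * (P * (S * Eᵀ)) = Eᵀ := by
    rw [← Matrix.mul_assoc, ← hM, ← Matrix.mul_assoc, hN2, Matrix.one_mul]
  have hmain := trace_transpose_mul_self_mul_le Pᵀ (P * (S * Eᵀ))
  rw [hfac, hgain, transpose_transpose, transpose_transpose, trace_mul_comm E,
    trace_mul_comm P, ← hM] at hmain
  refine hmain.trans (mul_le_mul_of_nonneg_left (by linarith) ?_)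
  rw [hM]
  exact trace_transpose_mul_self_nonneg P

section Unfolding

variable {N : ℕ} {Idim Kdim : Fin N → ℕ}

/-- The mode-`n` unfolding of `X` contracted with all factors but the `n`-th one. -/
def partialCore (X : (∀ n, Fin (Idim n)) → ℝ) (n : Fin N)
    (U : ∀ m, Matrix (Fin (Idim m)) (Fin (Kdim m)) ℝ) :
    Matrix (Fin (Idim n)) (∀ ν : {ν // ν ≠ n}, Fin (Kdim ν)) ℝ :=
  Matrix.of fun a j =>
    ∑ i : ∀ ν, Fin (Idim ν), if i n = a then X i * ∏ ν : {ν // ν ≠ n}, U ν (i ν) (j ν) else 0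

lemma partialCore_congr (X : (∀ n, Fin (Idim n)) → ℝ) (n : Fin N)
    {U V : ∀ m, Matrix (Fin (Idim m)) (Fin (Kdim m)) ℝ} (h : ∀ m, m ≠ n → U m = V m) :
    partialCore X n U = partialCore X n V := by
  ext a j
  simp only [partialCore, of_apply]
  refine Finset.sum_congr rfl fun i _ => ?_
  congr 2
  exact Finset.prod_congr rfl fun ν _ => by rw [h ν ν.2]

lemma core_piSplitAt_symm (X : (∀ n, Fin (Idim n)) → ℝ) (n : Fin N)
    (U : ∀ m, Matrix (Fin (Idim m)) (Fin (Kdim m)) ℝ) (b : Fin (Kdim n))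
    (j : ∀ ν : {ν // ν ≠ n}, Fin (Kdim ν)) :
    core X U ((Equiv.piSplitAt n fun ν => Fin (Kdim ν)).symm (b, j)) =
      ((partialCore X n U)ᵀ * U n) j b := by
  simp only [core, mul_apply, transpose_apply, partialCore, of_apply, Finset.sum_mul]
  rw [Finset.sum_comm]
  refine Finset.sum_congr rfl fun i _ => ?_
  simp only [ite_mul, zero_mul, Finset.sum_ite_eq, Finset.mem_univ, if_true]
  rw [Fintype.prod_eq_mul_prod_subtype_ne _ n]
  have h : ∀ ν : {ν // ν ≠ n},
      (Equiv.piSplitAt n fun ν => Fin (Kdim ν)).symm (b, j) ν = j ν := fun ν => by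
    simp [Equiv.piSplitAt, ν.2]
  simp only [h]
  simp [Equiv.piSplitAt]
  ring

lemma sum_eq_sum_piSplitAt (n : Fin N) (F : (∀ ν, Fin (Kdim ν)) → ℝ) :
    ∑ k, F k = ∑ b, ∑ j, F ((Equiv.piSplitAt n fun ν => Fin (Kdim ν)).symm (b, j)) := by
  rw [← Fintype.sum_prod_type', ← Equiv.sum_comp (Equiv.piSplitAt n fun ν => Fin (Kdim ν)).symm]

lemma obj_eq_trace (X : (∀ n, Fin (Idim n)) → ℝ) (n : Fin N)
    (U : ∀ m, Matrix (Fin (Idim m)) (Fin (Kdim m)) ℝ) :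
    obj X U = trace (((partialCore X n U)ᵀ * U n)ᵀ * ((partialCore X n U)ᵀ * U n)) := by
  simp only [obj, sum_eq_sum_piSplitAt n, core_piSplitAt_symm, trace_transpose_mul_self_eq_sum]

lemma gramCore_eq (X : (∀ n, Fin (Idim n)) → ℝ) (n : Fin N)
    (U : ∀ m, Matrix (Fin (Idim m)) (Fin (Kdim m)) ℝ) :
    gramCore X n U = ((partialCore X n U)ᵀ * U n)ᵀ * ((partialCore X n U)ᵀ * U n) := by
  ext a b
  have hup : ∀ (c : Fin (Kdim n)) (j : ∀ ν : {ν // ν ≠ n}, Fin (Kdim ν)),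
      Function.update ((Equiv.piSplitAt n fun ν => Fin (Kdim ν)).symm (c, j)) n b =
        (Equiv.piSplitAt n fun ν => Fin (Kdim ν)).symm (b, j) := fun c j => by
    ext ν
    by_cases h : ν = n
    · subst h
      simp [Equiv.piSplitAt]
    · simp [Equiv.piSplitAt, h]
  have hn : ∀ (c : Fin (Kdim n)) (j : ∀ ν : {ν // ν ≠ n}, Fin (Kdim ν)),
      (Equiv.piSplitAt n fun ν => Fin (Kdim ν)).symm (c, j) n = c := fun c j => by
    simp [Equiv.piSplitAt]
  rw [gramCore, of_apply, sum_eq_sum_piSplitAt n, Finset.sum_comm]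
  simp only [hup, hn, core_piSplitAt_symm, Finset.sum_ite_eq', Finset.mem_univ, if_true]
  rw [mul_apply]
  rfl

lemma ttmctc_eq (X : (∀ n, Fin (Idim n)) → ℝ) (n : Fin N)
    (U : ∀ m, Matrix (Fin (Idim m)) (Fin (Kdim m)) ℝ) :
    ttmctc X n U = partialCore X n U * ((partialCore X n U)ᵀ * U n) := by
  ext a b
  have hn : ∀ (c : Fin (Kdim n)) (j : ∀ ν : {ν // ν ≠ n}, Fin (Kdim ν)),
      (Equiv.piSplitAt n fun ν => Fin (Kdim ν)).symm (c, j) n = c := fun c j => by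
    simp [Equiv.piSplitAt]
  have hprod : ∀ (i : ∀ ν, Fin (Idim ν)) (c : Fin (Kdim n))
      (j : ∀ ν : {ν // ν ≠ n}, Fin (Kdim ν)),
      ∏ ν ∈ Finset.univ.erase n,
        U ν (i ν) ((Equiv.piSplitAt n fun ν => Fin (Kdim ν)).symm (c, j) ν) =
      ∏ ν : {ν // ν ≠ n}, U ν (i ν) (j ν) := fun i c j => by
    rw [Finset.prod_subtype (p := fun ν => ν ≠ n) _ (by simp)]
    refine Finset.prod_congr rfl fun ν _ => ?_
    simp [Equiv.piSplitAt, ν.2]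
  rw [ttmctc, of_apply, mul_apply]
  simp only [sum_eq_sum_piSplitAt n (Kdim := Kdim), hn, hprod, core_piSplitAt_symm]
  conv_rhs =>
    enter [2, j, 1]
    rw [partialCore, of_apply]
  simp only [Finset.sum_mul]
  rw [Finset.sum_comm (s := (Finset.univ : Finset (∀ ν : {ν // ν ≠ n}, Fin (Kdim ν))))]
  refine Finset.sum_congr rfl fun i _ => ?_
  rw [Finset.sum_comm]
  refine Finset.sum_congr rfl fun j _ => ?_
  by_cases h : i n = a
  · simp only [h, true_and, Finset.sum_ite_eq', Finset.mem_univ, if_true]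
    ring
  · simp [h]

end Unfolding

lemma IsHOQRI.transpose_mul_self {N : ℕ} {hN : 0 < N} {Idim Kdim : Fin N → ℕ}
    {X : (∀ n, Fin (Idim n)) → ℝ} {U : ℕ → ∀ n, Matrix (Fin (Idim n)) (Fin (Kdim n)) ℝ}
    (hU : IsHOQRI hN X U) (t : ℕ) (n : Fin N) : (U t n)ᵀ * U t n = 1 := by
  induction t with
  | zero => exact hU.1 n
  | succ t ih =>
    obtain ⟨horth, -, -, hother⟩ := hU.2 t
    by_cases h : n = blockAt hN t
    · rw [h]
      exact horth
    · rw [hother n h]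
      exact ih

lemma frobSq_nonneg {I K : ℕ} (M : Matrix (Fin I) (Fin K) ℝ) : 0 ≤ frobSq M :=
  trace_transpose_mul_self_nonneg M

/-- The squared partial gradient at an HOQRI step is controlled by the gain in the objective. -/
lemma IsHOQRI.frobSq_gradient_le {N : ℕ} {hN : 0 < N} {Idim Kdim : Fin N → ℕ}
    {X : (∀ n, Fin (Idim n)) → ℝ} {U : ℕ → ∀ n, Matrix (Fin (Idim n)) (Fin (Kdim n)) ℝ}
    (hU : IsHOQRI hN X U) (t : ℕ) :
    frobSq ((2 : ℝ) • ttmctc X (blockAt hN t) (U t) -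
        (2 : ℝ) • (U t (blockAt hN t) * gramCore X (blockAt hN t) (U t))) ≤
      4 * (obj X (U t) * (obj X (U (t + 1)) - obj X (U t))) := by
  obtain ⟨horth, hinj, hrange, hother⟩ := hU.2 t
  rw [ttmctc_eq] at hinj hrange
  have h := projected_gradient_sq_le _ _ _ (hU.transpose_mul_self t _) horth hinj hrange
  rw [← obj_eq_trace, ← gramCore_eq, ← ttmctc_eq,
    ← partialCore_congr X (blockAt hN t) hother, ← obj_eq_trace] at h
  rw [frobSq, ← smul_sub, transpose_smul, Matrix.smul_mul, Matrix.mul_smul, trace_smul,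
    trace_smul, smul_eq_mul, smul_eq_mul]
  linarith

/-- Summed gradient bound and vanishing partial gradients for HOQRI. With `f_sup` the
supremum of the objective over all tuples of factor matrices with orthonormal
columns, `∑_{t=0}^{T} ‖2A_t⁽ⁿᵗ⁾ − 2U_t⁽ⁿᵗ⁾M_t⁽ⁿᵗ⁾‖_F² ≤ 4 f_sup²` for every `T`, and
consequently `‖2A_t⁽ⁿᵗ⁾ − 2U_t⁽ⁿᵗ⁾M_t⁽ⁿᵗ⁾‖_F → 0` as `t → ∞`. -/
theorem hoqri_summed_gradient_bound {N : ℕ} (hN : 0 < N)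
    {Idim Kdim : Fin N → ℕ} (X : (∀ n, Fin (Idim n)) → ℝ)
    (U : ℕ → ∀ n, Matrix (Fin (Idim n)) (Fin (Kdim n)) ℝ)
    (hU : IsHOQRI hN X U)
    (fsup : ℝ)
    (hsup : IsLUB {y : ℝ | ∃ V : ∀ n, Matrix (Fin (Idim n)) (Fin (Kdim n)) ℝ,
      (∀ n, (V n)ᵀ * V n = 1) ∧ y = obj X V} fsup) :
    (∀ T : ℕ,
      ∑ t ∈ Finset.range (T + 1),
        frobSq ((2 : ℝ) • ttmctc X (blockAt hN t) (U t) -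
          (2 : ℝ) • (U t (blockAt hN t) * gramCore X (blockAt hN t) (U t))) ≤
        4 * fsup ^ 2) ∧
    Filter.Tendsto
      (fun t : ℕ => Real.sqrt (frobSq ((2 : ℝ) • ttmctc X (blockAt hN t) (U t) -
        (2 : ℝ) • (U t (blockAt hN t) * gramCore X (blockAt hN t) (U t)))))
      Filter.atTop (nhds 0) := by
  have hobj_nonneg : ∀ t, 0 ≤ obj X (U t) := fun t => Finset.sum_nonneg fun k _ => sq_nonneg _
  have hobj_le : ∀ t, obj X (U t) ≤ fsup := fun t =>
    hsup.1 ⟨U t, hU.transpose_mul_self t, rfl⟩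
  have hstep : ∀ t, frobSq ((2 : ℝ) • ttmctc X (blockAt hN t) (U t) -
      (2 : ℝ) • (U t (blockAt hN t) * gramCore X (blockAt hN t) (U t))) ≤
      4 * fsup * (obj X (U (t + 1)) - obj X (U t)) := fun t => by
    have h := hU.frobSq_gradient_le t
    have hprod := (frobSq_nonneg _).trans h
    have hgain : 0 ≤ obj X (U (t + 1)) - obj X (U t) := by
      rcases (hobj_nonneg t).eq_or_lt with h0 | h0
      · rw [← h0, sub_zero]
        exact hobj_nonneg _
      · exact nonneg_of_mul_nonneg_right (by linarith) h0
    have := mul_le_mul_of_nonneg_right (hobj_le t) hgain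
    linarith
  have hbound : ∀ T : ℕ, ∑ t ∈ Finset.range T,
      frobSq ((2 : ℝ) • ttmctc X (blockAt hN t) (U t) -
        (2 : ℝ) • (U t (blockAt hN t) * gramCore X (blockAt hN t) (U t))) ≤
      4 * fsup ^ 2 := fun T => by
    refine (Finset.sum_le_sum fun t _ => hstep t).trans ?_
    rw [← Finset.mul_sum, Finset.sum_range_sub (fun t => obj X (U t))]
    have hfsup : 0 ≤ fsup := (hobj_nonneg 0).trans (hobj_le 0)
    have := mul_le_mul_of_nonneg_left
      (show obj X (U T) - obj X (U 0) ≤ fsup by linarith [hobj_le T, hobj_nonneg 0]) hfsup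
    nlinarith
  refine ⟨fun T => hbound (T + 1), ?_⟩
  have hlim := (summable_of_sum_range_le (fun _ => frobSq_nonneg _) hbound).tendsto_atTop_zero
  simpa using hlim.sqrt
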